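/- arXiv:2306.11845 — 4 statements merged into one kernel-verified Lean document; each statement's English description precedes it below -/
import Mathlib

section
/- Let θ : [0,∞) → ℝ be continuous and strictly monotone with range contained in an open interval of length at most π, and let ψ ∈ ℝ. Then the set {t ≥ 0 : ∃ k ∈ ℤ, ψ − θ(t) = k·(π/2)} contains at most two elements. -/
open Real

/-- If the bearing `θ` is continuous and strictly monotone on `[0, ∞)` with range contained in
an open interval of length at most `π`, then the relative angle `ψ − θ(t)` is an integer
multiple of `π/2` for at most two times `t ≥ 0`. -/
theorem transition_points_le_two
    (θ : ℝ → ℝ) (hcont : ContinuousOn θ (Set.Ici (0 : ℝ)))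
    (hmono : StrictMonoOn θ (Set.Ici (0 : ℝ)) ∨ StrictAntiOn θ (Set.Ici (0 : ℝ)))
    (a b : ℝ) (hab : b - a ≤ π) (hrange : θ '' Set.Ici (0 : ℝ) ⊆ Set.Ioo a b)
    (ψ : ℝ) :
    {t : ℝ | 0 ≤ t ∧ ∃ k : ℤ, ψ - θ t = k * (π / 2)}.encard ≤ 2 := by
  have hinj : Set.InjOn θ (Set.Ici 0) := hmono.elim StrictMonoOn.injOn StrictAntiOn.injOn
  have hpi : 0 < π / 2 := by positivity
  set n : ℤ := ⌊(ψ - b) / (π / 2)⌋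
  have hn : (n : ℝ) * (π / 2) ≤ ψ - b := (le_div_iff₀ hpi).1 (Int.floor_le _)
  have hn' : ψ - b < (n + 1) * (π / 2) := (div_lt_iff₀ hpi).1 (Int.lt_floor_add_one _)
  have hfloor : ∀ t, ∀ k : ℤ, ψ - θ t = k * (π / 2) → ⌊(ψ - θ t) / (π / 2)⌋ = k := by
    intro t k hk
    rw [hk, mul_div_cancel_right₀ _ hpi.ne', Int.floor_intCast]
  calc _ ≤ ({n + 1, n + 2} : Set ℤ).encard := by
        refine Set.encard_le_encard_of_injOn (f := fun t => ⌊(ψ - θ t) / (π / 2)⌋) ?_ ?_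
        · rintro t ⟨ht, k, hk⟩
          obtain ⟨hat, htb⟩ := hrange (Set.mem_image_of_mem θ ht)
          have hlow : n < k := by
            have : (n : ℝ) < k := lt_of_mul_lt_mul_right (by linarith) hpi.le
            exact_mod_cast this
          have hhigh : k < n + 3 := by
            have : (k : ℝ) < n + 3 := lt_of_mul_lt_mul_right (by linarith) hpi.le
            exact_mod_cast this
          simp only [hfloor t k hk, Set.mem_insert_iff, Set.mem_singleton_iff]
          lia
        · rintro s ⟨hs, k, hk⟩ t ⟨ht, l, hl⟩ hst
          have hkl : k = l := by simpa only [hfloor s k hk, hfloor t l hl] using hst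
          subst hkl
          exact hinj hs ht (by linarith)
    _ ≤ 2 := (Set.encard_pair (by lia)).le
end

section
/- Let θ : [0,∞) → ℝ be continuous and strictly monotone with range contained in an open interval of length at most π, and let ψ_s, ψ_g ∈ ℝ. Then the set {t ≥ 0 : (∃ k ∈ ℤ, ψ_s − θ(t) = k·(π/2)) ∨ (∃ k ∈ ℤ, ψ_g − θ(t) = k·(π/2))} contains at most four elements. -/
open Real

/-- In an open interval of length at most `π`, the angles at which `ψ - x` is an integer multiple
of `π / 2` all lie in a set of two points. -/
theorem exists_pair_of_sub_eq_int_mul_pi_div_two {a b : ℝ} (hab : b - a ≤ π) (ψ : ℝ) :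
    ∃ p q : ℝ, ∀ x ∈ Set.Ioo a b, (∃ k : ℤ, ψ - x = k * (π / 2)) → x = p ∨ x = q := by
  have hπ : 0 < π / 2 := by positivity
  set y := (ψ - a) / (π / 2)
  have hya : y * (π / 2) = ψ - a := div_mul_cancel₀ _ hπ.ne'
  refine ⟨ψ - ((⌈y⌉ - 1 : ℤ) : ℝ) * (π / 2), ψ - ((⌈y⌉ - 2 : ℤ) : ℝ) * (π / 2), ?_⟩
  rintro x ⟨hax, hxb⟩ ⟨k, hk⟩
  have hlt : (k : ℝ) < y := lt_of_mul_lt_mul_right (by linarith) hπ.le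
  have hgt : y < k + 2 := lt_of_mul_lt_mul_right (by linarith) hπ.le
  have hk_lt : k < ⌈y⌉ := Int.lt_ceil.mpr hlt
  have hk_ge : ⌈y⌉ ≤ k + 2 := Int.ceil_le.mpr (by push_cast; exact hgt.le)
  obtain h | h : k = ⌈y⌉ - 1 ∨ k = ⌈y⌉ - 2 := by omega
  · left; rw [← h]; linarith
  · right; rw [← h]; linarith

/-- If the bearing `θ` is continuous and strictly monotone on `[0, ∞)` with range contained in
an open interval of length at most `π`, then there are at most four times `t ≥ 0` at which
either relative angle `ψ_s − θ(t)` or `ψ_g − θ(t)` is an integer multiple of `π/2`. -/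
theorem transition_points_le_four
    (θ : ℝ → ℝ) (hcont : ContinuousOn θ (Set.Ici (0 : ℝ)))
    (hmono : StrictMonoOn θ (Set.Ici (0 : ℝ)) ∨ StrictAntiOn θ (Set.Ici (0 : ℝ)))
    (a b : ℝ) (hab : b - a ≤ π) (hrange : θ '' Set.Ici (0 : ℝ) ⊆ Set.Ioo a b)
    (ψs ψg : ℝ) :
    {t : ℝ | 0 ≤ t ∧ ((∃ k : ℤ, ψs - θ t = k * (π / 2)) ∨
                      (∃ k : ℤ, ψg - θ t = k * (π / 2)))}.encard ≤ 4 := by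
  have hinj : Set.InjOn θ (Set.Ici 0) := hmono.elim StrictMonoOn.injOn StrictAntiOn.injOn
  obtain ⟨p, q, hs⟩ := exists_pair_of_sub_eq_int_mul_pi_div_two hab ψs
  obtain ⟨r, u, hg⟩ := exists_pair_of_sub_eq_int_mul_pi_div_two hab ψg
  rw [← (hinj.mono fun t ht => ht.1).encard_image]
  calc
    _ ≤ ((({p, q, r, u} : Finset ℝ) : Set ℝ)).encard := by
      refine Set.encard_le_encard ?_
      rintro _ ⟨t, ⟨ht, h⟩, rfl⟩
      have hmem : θ t ∈ Set.Ioo a b := hrange ⟨t, ht, rfl⟩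
      have hpair := h.imp (hs _ hmem) (hg _ hmem)
      simpa [or_assoc] using hpair
    _ ≤ 4 := by
      rw [Set.encard_coe_eq_coe_finsetCard]
      exact_mod_cast Finset.card_le_four
end

section
/- Let V_a > 0, V_w > 0 with V_w < V_a, and let γ ∈ ℝ. Set σ = arcsin((V_w/V_a)·sin γ). Then there exists c > 0 such that (V_a·cos(γ + σ) + V_w, V_a·sin(γ + σ)) = c·(cos γ, sin γ). -/
open Real

/-- Wind-triangle correction for the straight segment: with crab angle
`σ = arcsin((V_w/V_a)·sin γ)`, the ground velocity `(V_a cos(γ+σ) + V_w, V_a sin(γ+σ))`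
points exactly in the direction `(cos γ, sin γ)`. -/
theorem straight_segment_ground_track
    (Va Vw γ : ℝ) (hVa : 0 < Va) (hVw : 0 < Vw) (h : Vw < Va) :
    ∃ c : ℝ, 0 < c ∧
      Va * Real.cos (γ + Real.arcsin (Vw / Va * Real.sin γ)) + Vw = c * Real.cos γ ∧
      Va * Real.sin (γ + Real.arcsin (Vw / Va * Real.sin γ)) = c * Real.sin γ := by
  have hsσ : Va * sin (arcsin (Vw / Va * sin γ)) = Vw * sin γ := by
    have habs : |Vw / Va * sin γ| ≤ 1 := by
      rw [abs_mul, abs_of_pos (div_pos hVw hVa)]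
      exact mul_le_one₀ ((div_le_one hVa).2 h.le) (abs_nonneg _) (abs_sin_le_one γ)
    rw [sin_arcsin (neg_le_of_abs_le habs) (le_of_abs_le habs)]
    field_simp
  have hcσ : 0 ≤ cos (arcsin (Vw / Va * sin γ)) := cos_arcsin_nonneg _
  generalize arcsin (Vw / Va * sin γ) = σ at hsσ hcσ ⊢
  have hγ := sin_sq_add_cos_sq γ
  refine ⟨Va * cos σ + Vw * cos γ, ?_, ?_, ?_⟩
  · have hsq : (Vw * cos γ) ^ 2 < (Va * cos σ) ^ 2 := by
      have hV : Vw ^ 2 < Va ^ 2 := by gcongr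
      linear_combination hV + Vw ^ 2 * hγ - Va ^ 2 * sin_sq_add_cos_sq σ +
        (Va * sin σ + Vw * sin γ) * hsσ
    linarith [(abs_lt_of_sq_lt_sq' hsq (mul_nonneg hVa.le hcσ)).1]
  · rw [cos_add]
    linear_combination -sin γ * hsσ - Vw * hγ
  · rw [sin_add]
    linear_combination cos γ * hsσ
end

section
/- Define mod2π(x) = x − 2π·⌊x/(2π)⌋ and atan2(y, x) = Complex.arg(x + y·I). For α, β ∈ ℝ and d > 0 define the unit-turning-radius Dubins path lengths: L_RSR = mod2π(α − φ₁) + √(2 + d² − 2cos(α−β) + 2d(sin β − sin α)) + mod2π(φ₁ − β) where φ₁ = atan2(cos α − cos β, d − sin α + sin β); L_LSL = mod2π(φ₂ − α) + √(2 + d² − 2cos(α−β) + 2d(sin α − sin β)) + mod2π(β − φ₂) where φ₂ = atan2(cos β − cos α, d + sin α − sin β); L_RSL = mod2π(α − φ₃ + ν₃) + p₃ + mod2π(β − φ₃ + ν₃) where p₃ = √(d² − 2 + 2cos(α−β) − 2d(sin α + sin β)), φ₃ = atan2(cos α + cos β, d − sin α − sin β), ν₃ = atan2(2, p₃); L_LSR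 = mod2π(−α + φ₄ + ν₄) + p₄ + mod2π(φ₄ + ν₄ − β) where p₄ = √(d² − 2 + 2cos(α−β) + 2d(sin α + sin β)), φ₄ = atan2(−cos α − cos β, d + sin α + sin β), ν₄ = atan2(2, p₄). Then for α = 0.36, β = 3.111, and d = 4.01, one has L_LSR < L_RSR, L_LSR < L_RSL, and L_LSR < L_LSL. -/
open Real

/-- `x mod 2π`, taking values in `[0, 2π)`. -/
noncomputable def mod2pi (x : ℝ) : ℝ := x - 2 * π * ⌊x / (2 * π)⌋

/-- Two-argument arctangent via the complex argument. -/
noncomputable def atan2 (y x : ℝ) : ℝ := Complex.arg ((x : ℂ) + y * Complex.I)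

/-- Length of the RSR Dubins path (unit turning radius) from `(0,0,α)` to `(d,0,β)`. -/
noncomputable def dubinsRSR (α β d : ℝ) : ℝ :=
  let φ₁ := atan2 (Real.cos α - Real.cos β) (d - Real.sin α + Real.sin β)
  mod2pi (α - φ₁)
    + Real.sqrt (2 + d ^ 2 - 2 * Real.cos (α - β) + 2 * d * (Real.sin β - Real.sin α))
    + mod2pi (φ₁ - β)

/-- Length of the LSL Dubins path (unit turning radius) from `(0,0,α)` to `(d,0,β)`. -/
noncomputable def dubinsLSL (α β d : ℝ) : ℝ :=
  let φ₂ := atan2 (Real.cos β - Real.cos α) (d + Real.sin α - Real.sin β)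
  mod2pi (φ₂ - α)
    + Real.sqrt (2 + d ^ 2 - 2 * Real.cos (α - β) + 2 * d * (Real.sin α - Real.sin β))
    + mod2pi (β - φ₂)

/-- Length of the RSL Dubins path (unit turning radius) from `(0,0,α)` to `(d,0,β)`. -/
noncomputable def dubinsRSL (α β d : ℝ) : ℝ :=
  let p₃ := Real.sqrt (d ^ 2 - 2 + 2 * Real.cos (α - β) - 2 * d * (Real.sin α + Real.sin β))
  let φ₃ := atan2 (Real.cos α + Real.cos β) (d - Real.sin α - Real.sin β)
  let ν₃ := atan2 2 p₃
  mod2pi (α - φ₃ + ν₃) + p₃ + mod2pi (β - φ₃ + ν₃)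

/-- Length of the LSR Dubins path (unit turning radius) from `(0,0,α)` to `(d,0,β)`. -/
noncomputable def dubinsLSR (α β d : ℝ) : ℝ :=
  let p₄ := Real.sqrt (d ^ 2 - 2 + 2 * Real.cos (α - β) + 2 * d * (Real.sin α + Real.sin β))
  let φ₄ := atan2 (-Real.cos α - Real.cos β) (d + Real.sin α + Real.sin β)
  let ν₄ := atan2 2 p₄
  mod2pi (-α + φ₄ + ν₄) + p₄ + mod2pi (φ₄ + ν₄ - β)

/-- A representative of `x` modulo `2π` lying in `[0, 2π)` is `mod2pi x`. -/
lemma mod2pi_eq_of_mem {x : ℝ} (k : ℤ) (h₀ : 0 ≤ x + 2 * π * k) (h₁ : x + 2 * π * k < 2 * π) :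
    mod2pi x = x + 2 * π * k := by
  have hpi : 0 < 2 * π := Real.two_pi_pos
  have hfloor : ⌊x / (2 * π)⌋ = -k := by
    rw [Int.floor_eq_iff, le_div_iff₀ hpi, div_lt_iff₀ hpi]
    push_cast
    constructor <;> linarith
  rw [mod2pi, hfloor]
  push_cast
  ring

lemma mod2pi_eq_self {x : ℝ} (h₀ : 0 ≤ x) (h₁ : x < 2 * π) : mod2pi x = x := by
  simpa using mod2pi_eq_of_mem (x := x) 0 (by simpa using h₀) (by simpa using h₁)

lemma mod2pi_eq_add_two_pi {x : ℝ} (h₀ : -(2 * π) ≤ x) (h₁ : x < 0) :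
    mod2pi x = x + 2 * π := by
  simpa using mod2pi_eq_of_mem (x := x) 1 (by push_cast; linarith) (by push_cast; linarith)

lemma atan2_mem_Ioo {x : ℝ} (y : ℝ) (hx : 0 < x) : atan2 y x ∈ Set.Ioo (-(π / 2)) (π / 2) := by
  have h := Complex.abs_arg_lt_pi_div_two_iff (z := (x : ℂ) + y * Complex.I)
  exact abs_lt.1 (h.2 (Or.inl (by simpa using hx)))

lemma exists_pos_polar_atan2 {x : ℝ} (y : ℝ) (hx : 0 < x) :
    ∃ r : ℝ, 0 < r ∧ x = r * Real.cos (atan2 y x) ∧ y = r * Real.sin (atan2 y x) := by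
  have hz : (x : ℂ) + y * Complex.I ≠ 0 := by
    intro h
    have := congrArg Complex.re h
    simp at this
    exact hx.ne' this
  refine ⟨‖(x : ℂ) + y * Complex.I‖, norm_pos_iff.2 hz, ?_, ?_⟩
  · rw [atan2, Complex.norm_mul_cos_arg]
    simp
  · rw [atan2, Complex.norm_mul_sin_arg]
    simp

lemma atan2_le_of_mul_cos_le {x y c : ℝ} (hx : 0 < x) (hc : -(π / 2) < c)
    (h : y * Real.cos c ≤ x * Real.sin c) : atan2 y x ≤ c := by
  by_contra! hlt
  obtain ⟨r, hr, hcos, hsin⟩ := exists_pos_polar_atan2 y hx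
  have hmem := atan2_mem_Ioo y hx
  have hpos := Real.sin_pos_of_pos_of_lt_pi (x := atan2 y x - c) (by linarith)
    (by linarith [hmem.2])
  rw [Real.sin_sub] at hpos
  have := mul_pos hr hpos
  refine lt_irrefl (0 : ℝ) ?_
  linear_combination this + h - Real.cos c * hsin + Real.sin c * hcos

lemma le_atan2_of_le_mul_cos {x y c : ℝ} (hx : 0 < x) (hc : c < π / 2)
    (h : x * Real.sin c ≤ y * Real.cos c) : c ≤ atan2 y x := by
  by_contra! hlt
  obtain ⟨r, hr, hcos, hsin⟩ := exists_pos_polar_atan2 y hx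
  have hmem := atan2_mem_Ioo y hx
  have hpos := Real.sin_pos_of_pos_of_lt_pi (x := c - atan2 y x) (by linarith)
    (by linarith [hmem.1])
  rw [Real.sin_sub] at hpos
  have := mul_pos hr hpos
  refine lt_irrefl (0 : ℝ) ?_
  linear_combination this + h + Real.cos c * hsin - Real.sin c * hcos

lemma sin_mem_Icc_of_nonneg_of_le_one {x : ℝ} (h₀ : 0 ≤ x) (h₁ : x ≤ 1) :
    Real.sin x ∈ Set.Icc (x - x ^ 3 / 6 - x ^ 5 / 100) (x - x ^ 3 / 6 + x ^ 5 / 100) := by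
  have h := Real.sin_bound (abs_le.2 ⟨by linarith, h₁⟩)
  rw [abs_of_nonneg h₀, abs_le] at h
  constructor <;> linarith [h.1, h.2]

/-- The half-angle formula turns bounds on `sin (x / 2)` into bounds on `cos x`. -/
lemma cos_mem_Icc_of_sin_half {x a b : ℝ} (ha : 0 ≤ a) (h : Real.sin (x / 2) ∈ Set.Icc a b) :
    Real.cos x ∈ Set.Icc (1 - 2 * b ^ 2) (1 - 2 * a ^ 2) := by
  have hcos : Real.cos x = 1 - 2 * Real.sin (x / 2) ^ 2 := by
    rw [← Real.cos_sq_add_sin_sq (x / 2)]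
    nth_rewrite 1 [show x = 2 * (x / 2) by ring]
    rw [Real.cos_two_mul']
    ring
  have hs : 0 ≤ Real.sin (x / 2) := ha.trans h.1
  rw [hcos]
  constructor
  · have := pow_le_pow_left₀ hs h.2 2
    linarith
  · have := pow_le_pow_left₀ ha h.1 2
    linarith

/-- The double-angle formula turns bounds at `x / 2` into bounds on `sin x`. -/
lemma sin_mem_Icc_of_half {x a b c d : ℝ} (ha : 0 ≤ a) (hc : 0 ≤ c)
    (hs : Real.sin (x / 2) ∈ Set.Icc a b) (hcos : Real.cos (x / 2) ∈ Set.Icc c d) :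
    Real.sin x ∈ Set.Icc (2 * a * c) (2 * b * d) := by
  have hsin : Real.sin x = 2 * Real.sin (x / 2) * Real.cos (x / 2) := by
    rw [← Real.sin_two_mul]
    congr 1
    ring
  have hs₀ := ha.trans hs.1
  have hc₀ := hc.trans hcos.1
  rw [hsin, mul_assoc, mul_assoc, mul_assoc]
  exact ⟨by gcongr; exacts [hs.1, hcos.1], by gcongr; exacts [hs₀.trans hs.2, hs.2, hcos.2]⟩

lemma sin_cos_mem_Icc_alpha :
    Real.sin 0.36 ∈ Set.Icc (0.3522673 : ℝ) 0.352275 ∧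
      Real.cos 0.36 ∈ Set.Icc (0.9358965 : ℝ) 0.9358994 := by
  have hsq : Real.sin (0.36 / 2 / 2) ∈ Set.Icc (0.0898784 : ℝ) 0.0898786 :=
    Set.Icc_subset_Icc (by norm_num) (by norm_num)
      (sin_mem_Icc_of_nonneg_of_le_one (x := 0.36 / 2 / 2) (by norm_num) (by norm_num))
  have hsh : Real.sin (0.36 / 2) ∈ Set.Icc (0.1790261 : ℝ) 0.1790299 :=
    Set.Icc_subset_Icc (by norm_num) (by norm_num)
      (sin_mem_Icc_of_nonneg_of_le_one (x := 0.36 / 2) (by norm_num) (by norm_num))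
  have hch : Real.cos (0.36 / 2) ∈ Set.Icc (0.9838436 : ℝ) 0.9838438 :=
    Set.Icc_subset_Icc (by norm_num) (by norm_num) (cos_mem_Icc_of_sin_half (by norm_num) hsq)
  exact ⟨Set.Icc_subset_Icc (by norm_num) (by norm_num)
      (sin_mem_Icc_of_half (by norm_num) (by norm_num) hsh hch),
    Set.Icc_subset_Icc (by norm_num) (by norm_num) (cos_mem_Icc_of_sin_half (by norm_num) hsh)⟩

lemma sin_cos_mem_Icc_lsr_nu :
    Real.sin 0.4729 ∈ Set.Icc (0.4554434 : ℝ) 0.4554727 ∧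
      Real.cos 0.4729 ∈ Set.Icc (0.8902499 : ℝ) 0.890264 := by
  have hsq : Real.sin (0.4729 / 2 / 2) ∈ Set.Icc (0.1179493 : ℝ) 0.1179499 :=
    Set.Icc_subset_Icc (by norm_num) (by norm_num)
      (sin_mem_Icc_of_nonneg_of_le_one (x := 0.4729 / 2 / 2) (by norm_num) (by norm_num))
  have hsh : Real.sin (0.4729 / 2) ∈ Set.Icc (0.2342393 : ℝ) 0.2342542 :=
    Set.Icc_subset_Icc (by norm_num) (by norm_num)
      (sin_mem_Icc_of_nonneg_of_le_one (x := 0.4729 / 2) (by norm_num) (by norm_num))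
  have hch : Real.cos (0.4729 / 2) ∈ Set.Icc (0.9721756 : ℝ) 0.972176 :=
    Set.Icc_subset_Icc (by norm_num) (by norm_num) (cos_mem_Icc_of_sin_half (by norm_num) hsq)
  exact ⟨Set.Icc_subset_Icc (by norm_num) (by norm_num)
      (sin_mem_Icc_of_half (by norm_num) (by norm_num) hsh hch),
    Set.Icc_subset_Icc (by norm_num) (by norm_num) (cos_mem_Icc_of_sin_half (by norm_num) hsh)⟩

lemma sin_cos_mem_Icc_rsl_nu :
    Real.sin 0.5836 ∈ Set.Icc (0.5509572 : ℝ) 0.551039 ∧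
      Real.cos 0.5836 ∈ Set.Icc (0.8344802 : ℝ) 0.834529 := by
  have hsq : Real.sin (0.5836 / 2 / 2) ∈ Set.Icc (0.1453817 : ℝ) 0.1453831 :=
    Set.Icc_subset_Icc (by norm_num) (by norm_num)
      (sin_mem_Icc_of_nonneg_of_le_one (x := 0.5836 / 2 / 2) (by norm_num) (by norm_num))
  have hsh : Real.sin (0.5836 / 2) ∈ Set.Icc (0.2876378 : ℝ) 0.2876802 :=
    Set.Icc_subset_Icc (by norm_num) (by norm_num)
      (sin_mem_Icc_of_nonneg_of_le_one (x := 0.5836 / 2) (by norm_num) (by norm_num))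
  have hch : Real.cos (0.5836 / 2) ∈ Set.Icc (0.9577275 : ℝ) 0.9577284 :=
    Set.Icc_subset_Icc (by norm_num) (by norm_num) (cos_mem_Icc_of_sin_half (by norm_num) hsq)
  exact ⟨Set.Icc_subset_Icc (by norm_num) (by norm_num)
      (sin_mem_Icc_of_half (by norm_num) (by norm_num) hsh hch),
    Set.Icc_subset_Icc (by norm_num) (by norm_num) (cos_mem_Icc_of_sin_half (by norm_num) hsh)⟩

lemma sin_cos_mem_Icc_lsr_phi :
    Real.sin 0.0146 ∈ Set.Icc (0.0145994 : ℝ) 0.0145997 ∧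
      Real.cos 0.0146 ∈ Set.Icc (0.9998934 : ℝ) 0.9998935 := by
  have hsq : Real.sin (0.0146 / 2 / 2) ∈ Set.Icc (0.0036499 : ℝ) 0.00365 :=
    Set.Icc_subset_Icc (by norm_num) (by norm_num)
      (sin_mem_Icc_of_nonneg_of_le_one (x := 0.0146 / 2 / 2) (by norm_num) (by norm_num))
  have hsh : Real.sin (0.0146 / 2) ∈ Set.Icc (0.0072999 : ℝ) 0.0073 :=
    Set.Icc_subset_Icc (by norm_num) (by norm_num)
      (sin_mem_Icc_of_nonneg_of_le_one (x := 0.0146 / 2) (by norm_num) (by norm_num))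
  have hch : Real.cos (0.0146 / 2) ∈ Set.Icc (0.9999733 : ℝ) 0.9999734 :=
    Set.Icc_subset_Icc (by norm_num) (by norm_num) (cos_mem_Icc_of_sin_half (by norm_num) hsq)
  exact ⟨Set.Icc_subset_Icc (by norm_num) (by norm_num)
      (sin_mem_Icc_of_half (by norm_num) (by norm_num) hsh hch),
    Set.Icc_subset_Icc (by norm_num) (by norm_num) (cos_mem_Icc_of_sin_half (by norm_num) hsh)⟩

lemma sin_cos_mem_Icc_rsl_phi :
    Real.sin 0.0175 ∈ Set.Icc (0.0174989 : ℝ) 0.0174992 ∧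
      Real.cos 0.0175 ∈ Set.Icc (0.9998468 : ℝ) 0.9998469 := by
  have hsq : Real.sin (0.0175 / 2 / 2) ∈ Set.Icc (0.0043749 : ℝ) 0.004375 :=
    Set.Icc_subset_Icc (by norm_num) (by norm_num)
      (sin_mem_Icc_of_nonneg_of_le_one (x := 0.0175 / 2 / 2) (by norm_num) (by norm_num))
  have hsh : Real.sin (0.0175 / 2) ∈ Set.Icc (0.0087498 : ℝ) 0.0087499 :=
    Set.Icc_subset_Icc (by norm_num) (by norm_num)
      (sin_mem_Icc_of_nonneg_of_le_one (x := 0.0175 / 2) (by norm_num) (by norm_num))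
  have hch : Real.cos (0.0175 / 2) ∈ Set.Icc (0.9999617 : ℝ) 0.9999618 :=
    Set.Icc_subset_Icc (by norm_num) (by norm_num) (cos_mem_Icc_of_sin_half (by norm_num) hsq)
  exact ⟨Set.Icc_subset_Icc (by norm_num) (by norm_num)
      (sin_mem_Icc_of_half (by norm_num) (by norm_num) hsh hch),
    Set.Icc_subset_Icc (by norm_num) (by norm_num) (cos_mem_Icc_of_sin_half (by norm_num) hsh)⟩

lemma sin_cos_mem_Icc_two_fifths :
    Real.sin 0.4 ∈ Set.Icc (0.3894066 : ℝ) 0.3894196 ∧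
      Real.cos 0.4 ∈ Set.Icc (0.9210605 : ℝ) 0.9210658 := by
  have hsq : Real.sin (0.4 / 2 / 2) ∈ Set.Icc (0.0998332 : ℝ) 0.0998335 :=
    Set.Icc_subset_Icc (by norm_num) (by norm_num)
      (sin_mem_Icc_of_nonneg_of_le_one (x := 0.4 / 2 / 2) (by norm_num) (by norm_num))
  have hsh : Real.sin (0.4 / 2) ∈ Set.Icc (0.1986634 : ℝ) 0.1986699 :=
    Set.Icc_subset_Icc (by norm_num) (by norm_num)
      (sin_mem_Icc_of_nonneg_of_le_one (x := 0.4 / 2) (by norm_num) (by norm_num))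
  have hch : Real.cos (0.4 / 2) ∈ Set.Icc (0.9800665 : ℝ) 0.9800667 :=
    Set.Icc_subset_Icc (by norm_num) (by norm_num) (cos_mem_Icc_of_sin_half (by norm_num) hsq)
  exact ⟨Set.Icc_subset_Icc (by norm_num) (by norm_num)
      (sin_mem_Icc_of_half (by norm_num) (by norm_num) hsh hch),
    Set.Icc_subset_Icc (by norm_num) (by norm_num) (cos_mem_Icc_of_sin_half (by norm_num) hsh)⟩

lemma sin_mem_Icc_beta : Real.sin 3.111 ∈ Set.Icc (0.030587 : ℝ) 0.030589 := by
  have h₀ := Real.pi_gt_d6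
  have h₁ := Real.pi_lt_d6
  rw [← Real.sin_pi_sub]
  have h := sin_mem_Icc_of_nonneg_of_le_one (x := π - 3.111) (by linarith) (by linarith)
  have hl : (0.030592 : ℝ) ≤ π - 3.111 := by linarith
  have hu : π - 3.111 ≤ (0.030593 : ℝ) := by linarith
  have hl₃ := pow_le_pow_left₀ (by norm_num) hl 3
  have hu₃ := pow_le_pow_left₀ (by linarith) hu 3
  have hu₅ := pow_le_pow_left₀ (by linarith) hu 5
  norm_num at hl₃ hu₃ hu₅
  constructor <;> linarith [h.1, h.2]

lemma cos_mem_Icc_beta : Real.cos 3.111 ∈ Set.Icc (-0.999533 : ℝ) (-0.999531) := by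
  have h₀ := Real.pi_gt_d6
  have h₁ := Real.pi_lt_d6
  rw [← neg_neg (Real.cos 3.111), ← Real.cos_pi_sub]
  have hl : (0.030592 : ℝ) ≤ π - 3.111 := by linarith
  have hu : π - 3.111 ≤ (0.030593 : ℝ) := by linarith
  have h := Real.cos_bound (x := π - 3.111) (abs_le.2 ⟨by linarith, by linarith⟩)
  rw [abs_of_nonneg (by linarith : (0 : ℝ) ≤ π - 3.111), abs_le] at h
  have hl₂ := pow_le_pow_left₀ (by norm_num) hl 2
  have hu₂ := pow_le_pow_left₀ (by linarith) hu 2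
  have hu₄ := pow_le_pow_left₀ (by linarith) hu 4
  norm_num at hl₂ hu₂ hu₄
  constructor <;> linarith [h.1, h.2]

lemma cos_alpha_sub_beta_mem_Icc :
    Real.cos (0.36 - 3.111) ∈ Set.Icc (-0.9247 : ℝ) (-0.92467) := by
  obtain ⟨⟨hsa, hsa'⟩, hca, hca'⟩ := sin_cos_mem_Icc_alpha
  obtain ⟨hsb, hsb'⟩ := sin_mem_Icc_beta
  obtain ⟨hcb, hcb'⟩ := cos_mem_Icc_beta
  rw [Real.cos_sub]
  constructor <;> nlinarith

lemma dubinsLSR_le : dubinsLSR 0.36 3.111 4.01 ≤ 7.6993 := by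
  obtain ⟨⟨hsa, hsa'⟩, hca, hca'⟩ := sin_cos_mem_Icc_alpha
  obtain ⟨hsb, hsb'⟩ := sin_mem_Icc_beta
  obtain ⟨hcb, hcb'⟩ := cos_mem_Icc_beta
  obtain ⟨hcab, hcab'⟩ := cos_alpha_sub_beta_mem_Icc
  have hpi := Real.pi_gt_d6
  have hpi' := Real.pi_lt_d6
  unfold dubinsLSR
  extract_lets p φ ν
  have hp : 3.9115 ≤ p := Real.le_sqrt_of_sq_le (by linarith)
  have hp' : p ≤ 3.9118 := (Real.sqrt_le_left (by norm_num)).2 (by linarith)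
  have hφ : 0 ≤ φ := le_atan2_of_le_mul_cos (by linarith) (by linarith)
    (by rw [Real.sin_zero, Real.cos_zero]; linarith)
  have hφ' : φ ≤ 0.0146 := by
    obtain ⟨⟨hs, -⟩, -, hc⟩ := sin_cos_mem_Icc_lsr_phi
    exact atan2_le_of_mul_cos_le (by linarith) (by linarith) (by nlinarith)
  have hν : 0.4 ≤ ν := by
    obtain ⟨⟨-, hs⟩, hc, -⟩ := sin_cos_mem_Icc_two_fifths
    exact le_atan2_of_le_mul_cos (by linarith) (by linarith) (by nlinarith)
  have hν' : ν ≤ 0.4729 := by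
    obtain ⟨⟨hs, -⟩, -, hc⟩ := sin_cos_mem_Icc_lsr_nu
    exact atan2_le_of_mul_cos_le (by linarith) (by linarith) (by nlinarith)
  rw [mod2pi_eq_self (by linarith) (by linarith),
    mod2pi_eq_add_two_pi (x := φ + ν - 3.111) (by linarith) (by linarith)]
  linarith

lemma lt_dubinsRSL : 7.6993 < dubinsRSL 0.36 3.111 4.01 := by
  obtain ⟨⟨hsa, hsa'⟩, hca, hca'⟩ := sin_cos_mem_Icc_alpha
  obtain ⟨hsb, hsb'⟩ := sin_mem_Icc_beta
  obtain ⟨hcb, hcb'⟩ := cos_mem_Icc_beta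
  obtain ⟨hcab, hcab'⟩ := cos_alpha_sub_beta_mem_Icc
  have hpi := Real.pi_gt_d6
  have hpi' := Real.pi_lt_d6
  unfold dubinsRSL
  extract_lets p φ ν
  have hp : 3.0265 ≤ p := Real.le_sqrt_of_sq_le (by linarith)
  have hp' : p ≤ 3.0267 := (Real.sqrt_le_left (by norm_num)).2 (by linarith)
  have hφ : -(π / 2) < φ := (atan2_mem_Ioo _ (by linarith)).1
  have hφ' : φ ≤ -0.0175 := by
    obtain ⟨⟨-, hs⟩, hc, -⟩ := sin_cos_mem_Icc_rsl_phi
    refine atan2_le_of_mul_cos_le (by linarith) (by linarith) ?_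
    rw [Real.sin_neg, Real.cos_neg]
    nlinarith
  have hν : 0.5836 ≤ ν := by
    obtain ⟨⟨-, hs⟩, hc, -⟩ := sin_cos_mem_Icc_rsl_nu
    exact le_atan2_of_le_mul_cos (by linarith) (by linarith) (by nlinarith)
  have hν' : ν < π / 2 := (atan2_mem_Ioo _ (by linarith)).2
  rw [mod2pi_eq_self (by linarith) (by linarith), mod2pi_eq_self (by linarith) (by linarith)]
  linarith

lemma lt_dubinsRSR : 7.6993 < dubinsRSR 0.36 3.111 4.01 := by
  obtain ⟨⟨hsa, hsa'⟩, hca, hca'⟩ := sin_cos_mem_Icc_alpha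
  obtain ⟨hsb, hsb'⟩ := sin_mem_Icc_beta
  obtain ⟨hcb, hcb'⟩ := cos_mem_Icc_beta
  have hpi := Real.pi_gt_d6
  have hpi' := Real.pi_lt_d6
  unfold dubinsRSR
  extract_lets φ
  have hφ : 0.4 ≤ φ := by
    obtain ⟨⟨-, hs⟩, hc, -⟩ := sin_cos_mem_Icc_two_fifths
    exact le_atan2_of_le_mul_cos (by linarith) (by linarith) (by nlinarith)
  have hφ' : φ < π / 2 := (atan2_mem_Ioo _ (by linarith)).2
  rw [mod2pi_eq_add_two_pi (by linarith) (by linarith),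
    mod2pi_eq_add_two_pi (x := φ - 3.111) (by linarith) (by linarith)]
  have := Real.sqrt_nonneg (2 + 4.01 ^ 2 - 2 * Real.cos (0.36 - 3.111) +
    2 * 4.01 * (Real.sin 3.111 - Real.sin 0.36))
  linarith

lemma lt_dubinsLSL : 7.6993 < dubinsLSL 0.36 3.111 4.01 := by
  obtain ⟨⟨hsa, hsa'⟩, hca, hca'⟩ := sin_cos_mem_Icc_alpha
  obtain ⟨hsb, hsb'⟩ := sin_mem_Icc_beta
  obtain ⟨hcb, hcb'⟩ := cos_mem_Icc_beta
  have hpi := Real.pi_gt_d6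
  have hpi' := Real.pi_lt_d6
  unfold dubinsLSL
  extract_lets φ
  have hφ : -(π / 2) < φ := (atan2_mem_Ioo _ (by linarith)).1
  have hφ' : φ ≤ 0 := atan2_le_of_mul_cos_le (by linarith) (by linarith)
    (by rw [Real.sin_zero, Real.cos_zero]; linarith)
  rw [mod2pi_eq_add_two_pi (by linarith) (by linarith),
    mod2pi_eq_self (x := 3.111 - φ) (by linarith) (by linarith)]
  have := Real.sqrt_nonneg (2 + 4.01 ^ 2 - 2 * Real.cos (0.36 - 3.111) +
    2 * 4.01 * (Real.sin 0.36 - Real.sin 3.111))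
  linarith

/-- Counterexample to Proposition 9 of Shkel–Lumelsky for the quadrant pair `a₁₂`:
for `α = 0.36`, `β = 3.111`, `d = 4.01`, the LSR path is strictly shorter than each of
the RSR, RSL, and LSL paths. -/
theorem lsr_shortest_counterexample :
    dubinsLSR 0.36 3.111 4.01 < dubinsRSR 0.36 3.111 4.01 ∧
    dubinsLSR 0.36 3.111 4.01 < dubinsRSL 0.36 3.111 4.01 ∧
    dubinsLSR 0.36 3.111 4.01 < dubinsLSL 0.36 3.111 4.01 := by
  exact ⟨dubinsLSR_le.trans_lt lt_dubinsRSR, dubinsLSR_le.trans_lt lt_dubinsRSL,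
    dubinsLSR_le.trans_lt lt_dubinsLSL⟩
end
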